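/- arXiv:1402.1052 — 9 statements merged into one kernel-verified Lean document; each statement's English description precedes it below -/
import Mathlib

section
/- Suppose Δ > 0 and set c := γ/(1−γ)². Define A : [0,∞) → ℝ by A(s) = c·(1 − exp(−2√Δ·s)) / ((λ + √Δ) − (λ − √Δ)·exp(−2√Δ·s)). Then for every s ≥ 0 the denominator (λ + √Δ) − (λ − √Δ)·exp(−2√Δ·s) is strictly positive, A(0) = 0, and A is differentiable on [0,∞) with A′(s) = σ²A(s)² − 2λA(s) + c for all s ≥ 0. -/
/-- Case 1 (Δ > 0) of the Riccati initial value problem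
`A′(s) = σ²A(s)² − 2λA(s) + γ/(1−γ)²`, `A(0) = 0`:
the explicit formula has a positive denominator, vanishes at `0`,
and solves the ODE on `[0,∞)`. -/
theorem riccati_case_delta_pos
    (lam σ γ : ℝ) (hlam : 0 < lam) (hσ : 0 < σ) (hγ1 : γ < 1) (hγ0 : γ ≠ 0)
    (Δ : ℝ) (hΔdef : Δ = lam ^ 2 - γ * σ ^ 2 / (1 - γ) ^ 2) (hΔ : 0 < Δ)
    (c : ℝ) (hc : c = γ / (1 - γ) ^ 2)
    (A : ℝ → ℝ)
    (hA : ∀ s : ℝ, A s = c * (1 - Real.exp (-2 * Real.sqrt Δ * s)) /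
      ((lam + Real.sqrt Δ) - (lam - Real.sqrt Δ) * Real.exp (-2 * Real.sqrt Δ * s))) :
    (∀ s : ℝ, 0 ≤ s →
        0 < (lam + Real.sqrt Δ) - (lam - Real.sqrt Δ) * Real.exp (-2 * Real.sqrt Δ * s)) ∧
    A 0 = 0 ∧
    (∀ s : ℝ, 0 ≤ s → HasDerivAt A (σ ^ 2 * A s ^ 2 - 2 * lam * A s + c) s) := by
  set d := Real.sqrt Δ with hd
  have hdpos : 0 < d := Real.sqrt_pos.mpr hΔ
  have hsq : d ^ 2 = lam ^ 2 - σ ^ 2 * c := by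
    rw [hd, Real.sq_sqrt hΔ.le, hΔdef, hc]; ring
  have hpos : ∀ s : ℝ, 0 ≤ s →
      0 < (lam + d) - (lam - d) * Real.exp (-2 * d * s) := by
    intro s hs
    have h1 : Real.exp (-2 * d * s) ≤ 1 := by
      apply Real.exp_le_one_iff.mpr
      nlinarith [mul_nonneg hdpos.le hs]
    have h0 := Real.exp_pos (-2 * d * s)
    nlinarith [mul_nonneg hlam.le (sub_nonneg.mpr h1), mul_pos hdpos h0]
  refine ⟨hpos, ?_, ?_⟩
  · rw [hA]; simp
  · intro s hs
    have hD := hpos s hs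
    have hfun : A = fun s => c * (1 - Real.exp (-2 * d * s)) /
      ((lam + d) - (lam - d) * Real.exp (-2 * d * s)) := funext hA
    have hE : HasDerivAt (fun s : ℝ => Real.exp (-2 * d * s))
        (Real.exp (-2 * d * s) * (-2 * d)) s := by
      simpa using ((hasDerivAt_id s).const_mul (-2 * d)).exp
    have h := ((hE.const_sub 1).const_mul c).fun_div
      ((hE.const_mul (lam - d)).const_sub (lam + d)) hD.ne'
    rw [hA s, hfun]
    refine h.congr_deriv ?_
    generalize Real.exp (-2 * d * s) = E at hD
    have hne := hD.ne'
    generalize hDD : (lam + d) - (lam - d) * E = D at hD hne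
    field_simp
    subst hDD
    linear_combination (-c * (1 - E) ^ 2) * hsq
end

section
/- Suppose Δ = 0, i.e. γ/(1−γ)² = λ²/σ². Define A : [0,∞) → ℝ by A(s) = λ²s / (σ²λs + σ²). Then A(0) = 0 and A is differentiable on [0,∞) with A′(s) = σ²A(s)² − 2λA(s) + λ²/σ² for all s ≥ 0. -/
/-- Case 2 (Δ = 0, i.e. `γ/(1−γ)² = λ²/σ²`) of the Riccati initial value problem:
`A(s) = λ²s/(σ²λs + σ²)` satisfies `A(0) = 0` and
`A′(s) = σ²A(s)² − 2λA(s) + λ²/σ²` on `[0,∞)`. -/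
theorem riccati_case_delta_zero
    (lam σ γ : ℝ) (hlam : 0 < lam) (hσ : 0 < σ) (hγ1 : γ < 1) (hγ0 : γ ≠ 0)
    (hΔ0 : γ / (1 - γ) ^ 2 = lam ^ 2 / σ ^ 2)
    (A : ℝ → ℝ) (hA : ∀ s : ℝ, A s = lam ^ 2 * s / (σ ^ 2 * lam * s + σ ^ 2)) :
    A 0 = 0 ∧
    ∀ s : ℝ, 0 ≤ s →
      HasDerivAt A (σ ^ 2 * A s ^ 2 - 2 * lam * A s + lam ^ 2 / σ ^ 2) s := by
  refine ⟨by simp [hA], fun s hs => ?_⟩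
  have hu : lam * s + 1 ≠ 0 := by positivity
  have hd : σ ^ 2 * lam * s + σ ^ 2 ≠ 0 := by positivity
  have hd' : σ ^ 2 * lam * s + σ ^ 2 = σ ^ 2 * (lam * s + 1) := by ring
  have h1 : HasDerivAt (fun x : ℝ => lam ^ 2 * x) (lam ^ 2 * 1) s :=
    (hasDerivAt_id s).const_mul _
  have h2 : HasDerivAt (fun x : ℝ => σ ^ 2 * lam * x + σ ^ 2) (σ ^ 2 * lam * 1) s :=
    ((hasDerivAt_id s).const_mul _).add_const _
  have h3 := h1.fun_div h2 hd
  have hAe : A = fun x => lam ^ 2 * x / (σ ^ 2 * lam * x + σ ^ 2) := funext hA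
  rw [hA s, hAe]
  refine h3.congr_deriv ?_
  rw [hd']
  field_simp
  ring
end

section
/- Suppose Δ < 0 and set c := γ/(1−γ)² and S := (π/2 + arctan(λ/√(−Δ)))/√(−Δ) > 0. Define A : [0,S) → ℝ by A(s) = (1/σ²)·(λ + √(−Δ)·tan(√(−Δ)·s − arctan(λ/√(−Δ)))). Then A(0) = 0 and A is differentiable on [0,S) with A′(s) = σ²A(s)² − 2λA(s) + c for all s ∈ [0,S). -/
/-- Case 3 (Δ < 0) of the Riccati initial value problem: with
`S := (π/2 + arctan(λ/√(−Δ)))/√(−Δ) > 0`, the tangent formula vanishes at `0`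
and solves `A′(s) = σ²A(s)² − 2λA(s) + c` on `[0,S)`. -/
theorem riccati_case_delta_neg
    (lam σ γ : ℝ) (hlam : 0 < lam) (hσ : 0 < σ) (hγ1 : γ < 1) (hγ0 : γ ≠ 0)
    (Δ : ℝ) (hΔdef : Δ = lam ^ 2 - γ * σ ^ 2 / (1 - γ) ^ 2) (hΔ : Δ < 0)
    (c : ℝ) (hc : c = γ / (1 - γ) ^ 2)
    (S : ℝ) (hS : S = (Real.pi / 2 + Real.arctan (lam / Real.sqrt (-Δ))) / Real.sqrt (-Δ))
    (A : ℝ → ℝ)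
    (hA : ∀ s : ℝ, A s = (1 / σ ^ 2) * (lam + Real.sqrt (-Δ) *
      Real.tan (Real.sqrt (-Δ) * s - Real.arctan (lam / Real.sqrt (-Δ))))) :
    0 < S ∧ A 0 = 0 ∧
    ∀ s ∈ Set.Ico (0 : ℝ) S, HasDerivAt A (σ ^ 2 * A s ^ 2 - 2 * lam * A s + c) s := by
  have hr : 0 < Real.sqrt (-Δ) := Real.sqrt_pos.mpr (by linarith)
  have hr2 : Real.sqrt (-Δ) ^ 2 = -Δ := Real.sq_sqrt (by linarith)
  have hcσ : c = (lam ^ 2 - Δ) / σ ^ 2 := by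
    have h : c * σ ^ 2 = lam ^ 2 - Δ := by
      rw [hc, hΔdef]
      ring
    rw [← h]
    field_simp
  generalize Real.sqrt (-Δ) = r at *
  have hΔr : Δ = -r ^ 2 := by linarith
  have hθ1 : 0 < Real.arctan (lam / r) := Real.arctan_pos.mpr (div_pos hlam hr)
  have hθ2 := Real.arctan_lt_pi_div_two (lam / r)
  have hpi := Real.pi_pos
  refine ⟨by rw [hS]; positivity, ?_, ?_⟩
  · rw [hA, mul_zero, zero_sub, Real.tan_neg, Real.tan_arctan]
    field_simp
    ring
  · rintro s ⟨hs0, hsS⟩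
    rw [hS, lt_div_iff₀ hr] at hsS
    have hrs : 0 ≤ r * s := mul_nonneg hr.le hs0
    have hcos : Real.cos (r * s - Real.arctan (lam / r)) ≠ 0 :=
      (Real.cos_pos_of_mem_Ioo ⟨by linarith, by linarith⟩).ne'
    have hlin : HasDerivAt (fun x : ℝ => r * x - Real.arctan (lam / r)) r s := by
      simpa using ((hasDerivAt_id s).const_mul r).sub_const (Real.arctan (lam / r))
    have hd := ((((Real.hasDerivAt_tan hcos).comp s hlin).const_mul r).const_add lam).const_mul
      (1 / σ ^ 2)
    have hAe : A = fun s => (1 / σ ^ 2) * (lam + r *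
      Real.tan (r * s - Real.arctan (lam / r))) := funext hA
    have ht : 1 / Real.cos (r * s - Real.arctan (lam / r)) ^ 2
        = 1 + Real.tan (r * s - Real.arctan (lam / r)) ^ 2 := by
      rw [← Real.inv_one_add_tan_sq hcos, one_div, inv_inv]
    rw [ht] at hd
    rw [hA s, hcσ, hΔr, hAe]
    refine hd.congr_deriv ?_
    field_simp
    ring
end

section
/- Let b := σ²/λ² and γ_lim := 2/(2 + b + √((2+b)² − 4)). Then for every γ < 1 one has Δ = λ² − γσ²/(1−γ)² > 0 if and only if γ < γ_lim. -/
/-- With `b := σ²/λ²` and `γ_lim := 2/(2 + b + √((2+b)² − 4))`, for every `γ < 1` one has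
`Δ = λ² − γσ²/(1−γ)² > 0` if and only if `γ < γ_lim`. -/
theorem delta_pos_iff_gamma_lt_gamma_lim
    (lam σ : ℝ) (hlam : 0 < lam) (hσ : 0 < σ)
    (b : ℝ) (hb : b = σ ^ 2 / lam ^ 2)
    (γlim : ℝ) (hγlim : γlim = 2 / (2 + b + Real.sqrt ((2 + b) ^ 2 - 4))) :
    ∀ γ : ℝ, γ < 1 → (0 < lam ^ 2 - γ * σ ^ 2 / (1 - γ) ^ 2 ↔ γ < γlim) := by
  intro γ hγ
  have hb0 : 0 < b := by rw [hb]; positivity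
  have hs2 : Real.sqrt ((2 + b) ^ 2 - 4) ^ 2 = (2 + b) ^ 2 - 4 :=
    Real.sq_sqrt (by nlinarith)
  have hs0 : 0 ≤ Real.sqrt ((2 + b) ^ 2 - 4) := Real.sqrt_nonneg _
  set s := Real.sqrt ((2 + b) ^ 2 - 4) with hs
  have hg : γlim = (2 + b - s) / 2 := by
    have hne : 2 + b + s ≠ 0 := by positivity
    rw [hγlim, div_eq_div_iff hne two_ne_zero]
    linarith
  have hσb : σ ^ 2 = b * lam ^ 2 := by
    rw [hb]; field_simp
  have h1 : 0 < 1 - γ := by linarith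
  have key : lam ^ 2 - γ * σ ^ 2 / (1 - γ) ^ 2
      = (lam ^ 2 / (1 - γ) ^ 2 * ((2 + b + s) / 2 - γ)) * (γlim - γ) := by
    have e : ((2 + b + s) / 2 - γ) * (γlim - γ) = (1 - γ) ^ 2 - γ * b := by
      rw [hg]; linarith
    rw [mul_assoc, e, hσb]
    have := h1.ne'
    field_simp
  have hM : 0 < (2 + b + s) / 2 - γ := by linarith
  rw [key, mul_pos_iff_of_pos_left (by positivity), sub_pos]
end

section
/- Suppose Δ > 0 and let A : [0,∞) → ℝ be defined by A(s) = (γ/(1−γ)²)·(1 − exp(−2√Δ·s)) / ((λ + √Δ) − (λ − √Δ)·exp(−2√Δ·s)). Then: (i) if 0 < γ < 1, A is strictly increasing on [0,∞) and 0 < A(s) < (λ − √Δ)/σ² for all s > 0; (ii) if γ < 0, A is strictly decreasing on [0,∞) and (λ − √Δ)/σ² < A(s) < 0 for all s > 0; (iii) in both cases A(s) → (λ − √Δ)/σ² as s → ∞. -/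
/-- Monotonicity, sign and long-run limit of the Δ > 0 Riccati solution:
if `0 < γ < 1` then `A` is strictly increasing on `[0,∞)` with
`0 < A(s) < (λ−√Δ)/σ²` for `s > 0`; if `γ < 0` then `A` is strictly decreasing with
`(λ−√Δ)/σ² < A(s) < 0` for `s > 0`; in both cases `A(s) → (λ−√Δ)/σ²` as `s → ∞`. -/
theorem riccati_solution_monotonicity_and_limit
    (lam σ γ : ℝ) (hlam : 0 < lam) (hσ : 0 < σ) (hγ1 : γ < 1) (hγ0 : γ ≠ 0)
    (Δ : ℝ) (hΔdef : Δ = lam ^ 2 - γ * σ ^ 2 / (1 - γ) ^ 2) (hΔ : 0 < Δ)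
    (A : ℝ → ℝ)
    (hA : ∀ s : ℝ, A s = (γ / (1 - γ) ^ 2) * (1 - Real.exp (-2 * Real.sqrt Δ * s)) /
      ((lam + Real.sqrt Δ) - (lam - Real.sqrt Δ) * Real.exp (-2 * Real.sqrt Δ * s))) :
    (0 < γ → StrictMonoOn A (Set.Ici 0) ∧
      ∀ s : ℝ, 0 < s → 0 < A s ∧ A s < (lam - Real.sqrt Δ) / σ ^ 2) ∧
    (γ < 0 → StrictAntiOn A (Set.Ici 0) ∧
      ∀ s : ℝ, 0 < s → (lam - Real.sqrt Δ) / σ ^ 2 < A s ∧ A s < 0) ∧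
    Filter.Tendsto A Filter.atTop (nhds ((lam - Real.sqrt Δ) / σ ^ 2)) := by
  set d := Real.sqrt Δ with hd
  have hd0 : 0 < d := Real.sqrt_pos.mpr hΔ
  have hdd : d ^ 2 = Δ := Real.sq_sqrt hΔ.le
  set g := γ / (1 - γ) ^ 2 with hg
  have h1 : 0 < (1 - γ) ^ 2 := by
    have : 0 < 1 - γ := by linarith
    positivity
  have hgs : g * σ ^ 2 = lam ^ 2 - d ^ 2 := by
    rw [hdd, hΔdef, hg]; ring
  obtain ⟨φ, hφ⟩ : ∃ φ : ℝ → ℝ, ∀ e, φ e = (1 - e) / ((lam + d) - (lam - d) * e) := ⟨_, fun _ => rfl⟩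
  have hAφ : ∀ s, A s = g * φ (Real.exp (-2 * d * s)) := by
    intro s; rw [hA, hφ, mul_div_assoc]
  have hD : ∀ e, 0 ≤ e → e ≤ 1 → 0 < (lam + d) - (lam - d) * e := by
    intro e h0 h1
    have h2 : 0 ≤ lam * (1 - e) := mul_nonneg hlam.le (by linarith)
    have h3 : 0 ≤ d * e := mul_nonneg hd0.le h0
    nlinarith
  have hanti : ∀ x y, 0 ≤ x → x < y → y ≤ 1 → φ y < φ x := by
    intro x y h0 hxy h1
    rw [hφ, hφ, div_lt_div_iff₀ (hD y (by linarith) h1) (hD x h0 (by linarith))]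
    have : 0 < d * (y - x) := mul_pos hd0 (by linarith)
    nlinarith
  have hφ1 : φ 1 = 0 := by rw [hφ]; simp
  have hlim : g * φ 0 = (lam - d) / σ ^ 2 := by
    have : lam + d ≠ 0 := by positivity
    rw [hφ, eq_div_iff (by positivity)]
    simp only [mul_zero, sub_zero]
    field_simp
    linarith
  have hexp : ∀ s t, s < t → Real.exp (-2 * d * t) < Real.exp (-2 * d * s) := by
    intro s t hst
    apply Real.exp_lt_exp.mpr
    nlinarith
  have hexp1 : ∀ s, 0 ≤ s → Real.exp (-2 * d * s) ≤ 1 := by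
    intro s hs
    apply Real.exp_le_one_iff.mpr
    nlinarith [mul_nonneg hd0.le hs]
  have hmono : ∀ s t, 0 ≤ s → s < t → φ (Real.exp (-2 * d * s)) < φ (Real.exp (-2 * d * t)) :=
    fun s t hs hst => hanti _ _ (Real.exp_pos _).le (hexp s t hst) (hexp1 s hs)
  have hpos : ∀ s, 0 < s → 0 < φ (Real.exp (-2 * d * s)) := by
    intro s hs
    have := hmono 0 s le_rfl hs
    simpa [hφ1] using this
  have hub : ∀ s, 0 < s → φ (Real.exp (-2 * d * s)) < φ 0 :=
    fun s hs => hanti _ _ le_rfl (Real.exp_pos _) (hexp1 s hs.le)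
  refine ⟨fun hγ => ?_, fun hγ => ?_, ?_⟩
  · have hg0 : 0 < g := div_pos hγ h1
    refine ⟨fun s hs t _ hst => ?_, fun s hs => ⟨?_, ?_⟩⟩
    · rw [hAφ, hAφ]; exact mul_lt_mul_of_pos_left (hmono s t hs hst) hg0
    · rw [hAφ]; exact mul_pos hg0 (hpos s hs)
    · rw [hAφ, ← hlim]; exact mul_lt_mul_of_pos_left (hub s hs) hg0
  · have hg0 : g < 0 := div_neg_of_neg_of_pos hγ h1
    refine ⟨fun s hs t _ hst => ?_, fun s hs => ⟨?_, ?_⟩⟩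
    · rw [hAφ, hAφ]; exact mul_lt_mul_of_neg_left (hmono s t hs hst) hg0
    · rw [hAφ, ← hlim]; exact mul_lt_mul_of_neg_left (hub s hs) hg0
    · rw [hAφ]; exact mul_neg_of_neg_of_pos hg0 (hpos s hs)
  · rw [← hlim, show A = fun s => g * φ (Real.exp (-2 * d * s)) from funext hAφ]
    have hc : ContinuousAt φ 0 := by
      rw [show φ = fun e => (1 - e) / ((lam + d) - (lam - d) * e) from funext hφ]
      exact ContinuousAt.div (by fun_prop) (by fun_prop) (hD 0 le_rfl zero_le_one).ne'
    have he : Filter.Tendsto (fun s : ℝ => Real.exp (-2 * d * s)) Filter.atTop (nhds 0) :=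
      Real.tendsto_exp_atBot.comp
        (Filter.tendsto_id.const_mul_atTop_of_neg (by linarith))
    exact (hc.tendsto.comp he).const_mul g
end

section
/- Let λ > 0, θ̄ > 0, σ ∈ ℝ, S > 0, and let A₁ : [0,S] → ℝ be continuous. Suppose A₂ : [0,S] → ℝ is differentiable with A₂(0) = 0 and A₂′(s) = λ(θ̄·A₁(s) − A₂(s)) + σ²A₁(s)A₂(s) for all s ∈ [0,S]. If A₁(s) ≤ 0 for all s ∈ [0,S], then A₂(s) ≤ 0 for all s ∈ [0,S]; if A₁(s) ≥ 0 for all s ∈ [0,S], then A₂(s) ≥ 0 for all s ∈ [0,S]. -/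
theorem aux_nonpos (S M : ℝ) (f a b : ℝ → ℝ) (hf0 : f 0 = 0)
    (hf : ∀ s ∈ Set.Icc (0 : ℝ) S, HasDerivWithinAt f (a s * f s + b s) (Set.Icc (0 : ℝ) S) s)
    (ha : ∀ s ∈ Set.Icc (0 : ℝ) S, a s ≤ M) (hb : ∀ s ∈ Set.Icc (0 : ℝ) S, b s ≤ 0) :
    ∀ s ∈ Set.Icc (0 : ℝ) S, f s ≤ 0 := by
  intro s hs
  have key : ∀ ε : ℝ, 0 < ε → f s ≤ ε * Real.exp ((M + 1) * s) := by
    intro ε hε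
    have hB : ∀ x : ℝ, HasDerivAt (fun x => ε * Real.exp ((M + 1) * x))
        (ε * (Real.exp ((M + 1) * x) * ((M + 1) * 1))) x := fun x =>
      (((hasDerivAt_id x).const_mul (M + 1)).exp).const_mul ε
    refine image_le_of_deriv_right_lt_deriv_boundary (f := f)
      (f' := fun x => a x * f x + b x) (a := 0) (b := S)
      (fun x hx => (hf x hx).continuousWithinAt) ?_ ?_ hB ?_ hs
    · intro x hx
      exact (hf x ⟨hx.1, hx.2.le⟩).mono_of_mem_nhdsWithin
        (Icc_mem_nhdsGE_of_mem hx)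
    · simp [hf0, hε.le]
    · intro x hx hfx
      have hx' : x ∈ Set.Icc (0 : ℝ) S := ⟨hx.1, hx.2.le⟩
      have hp : 0 < ε * Real.exp ((M + 1) * x) := by positivity
      have h1 := hb x hx'
      have h2 := mul_le_mul_of_nonneg_right (ha x hx') hp.le
      simp only [hfx]
      nlinarith
  by_contra! h
  have hE := Real.exp_pos ((M + 1) * s)
  have := key (f s / (2 * Real.exp ((M + 1) * s))) (by positivity)
  have e : f s / (2 * Real.exp ((M + 1) * s)) * Real.exp ((M + 1) * s) = f s / 2 := by
    field_simp
  linarith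

/-- Sign preservation for the linear ODE
`A₂′(s) = λ(θ̄A₁(s) − A₂(s)) + σ²A₁(s)A₂(s)`, `A₂(0) = 0`:
if `A₁ ≤ 0` on `[0,S]` then `A₂ ≤ 0` on `[0,S]`, and
if `A₁ ≥ 0` on `[0,S]` then `A₂ ≥ 0` on `[0,S]`. -/
theorem linear_ode_sign_preservation
    (lam thetaBar σ S : ℝ) (hlam : 0 < lam) (hthetaBar : 0 < thetaBar) (hS : 0 < S)
    (A₁ A₂ : ℝ → ℝ) (hA₁ : ContinuousOn A₁ (Set.Icc (0 : ℝ) S))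
    (hA₂0 : A₂ 0 = 0)
    (hA₂ : ∀ s ∈ Set.Icc (0 : ℝ) S,
      HasDerivWithinAt A₂ (lam * (thetaBar * A₁ s - A₂ s) + σ ^ 2 * A₁ s * A₂ s)
        (Set.Icc (0 : ℝ) S) s) :
    ((∀ s ∈ Set.Icc (0 : ℝ) S, A₁ s ≤ 0) → ∀ s ∈ Set.Icc (0 : ℝ) S, A₂ s ≤ 0) ∧
    ((∀ s ∈ Set.Icc (0 : ℝ) S, 0 ≤ A₁ s) → ∀ s ∈ Set.Icc (0 : ℝ) S, 0 ≤ A₂ s) := by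
  obtain ⟨M, hM⟩ := isCompact_Icc.bddAbove_image hA₁
  have ha : ∀ s ∈ Set.Icc (0 : ℝ) S, -lam + σ ^ 2 * A₁ s ≤ -lam + σ ^ 2 * M := by
    intro s hs
    have := mul_le_mul_of_nonneg_left (hM (Set.mem_image_of_mem A₁ hs)) (sq_nonneg σ)
    linarith
  have hlt : 0 < lam * thetaBar := mul_pos hlam hthetaBar
  constructor
  · intro h
    refine aux_nonpos S _ A₂ (fun s => -lam + σ ^ 2 * A₁ s) (fun s => lam * thetaBar * A₁ s) hA₂0 ?_ ha ?_
    · intro s hs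
      convert hA₂ s hs using 1
      ring
    · intro s hs
      exact mul_nonpos_of_nonneg_of_nonpos hlt.le (h s hs)
  · intro h s hs
    have := aux_nonpos S _ (fun s => -A₂ s) (fun s => -lam + σ ^ 2 * A₁ s) (fun s => -(lam * thetaBar * A₁ s))
      (by simp [hA₂0]) ?_ ha ?_ s hs
    · simpa using this
    · intro s hs
      refine (hA₂ s hs).fun_neg.congr_deriv ?_
      beta_reduce
      ring
    · intro s hs
      have := mul_nonneg hlt.le (h s hs)
      simpa using this
end

section
/- Let S > 0, let γ < 1 with γ ≠ 0, let λ, σ, θ̄ ∈ ℝ, and let A₁, A₂, A₃ : [0,S] → ℝ be differentiable with A₁(0) = A₂(0) = A₃(0) = 0 and satisfying, for all s ∈ [0,S]: A₁′(s) = −2λA₁(s) + σ²A₁(s)² + γ/(1−γ)², A₂′(s) = λ(θ̄·A₁(s) − A₂(s)) + σ²A₁(s)A₂(s), and A₃′(s) = λθ̄·A₂(s) + (σ²/2)(A₁(s) + A₂(s)²). Define g : [0,S] × ℝ → ℝ by g(s,θ) = exp(A₁(s)·θ²/2 + A₂(s)·θ + A₃(s)). Then g(0,θ) = 1 for all θ,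 and for all (s,θ) ∈ [0,S] × ℝ: ∂ₛg(s,θ) + λ(θ − θ̄)·∂_θ g(s,θ) − (σ²/2)·∂²_{θθ} g(s,θ) − (γ/(2(1−γ)) + γ²/(2(1−γ)²))·θ²·g(s,θ) = 0. -/
/-- Verification of the exponential-quadratic ansatz: if `A₁, A₂, A₃` solve the stated ODE
system with zero initial conditions, then `g(s,θ) = exp(A₁(s)θ²/2 + A₂(s)θ + A₃(s))`
satisfies `g(0,·) = 1` and the PDE
`∂ₛg + λ(θ−θ̄)∂_θg − (σ²/2)∂²_{θθ}g − (γ/(2(1−γ)) + γ²/(2(1−γ)²))θ²g = 0` on `[0,S] × ℝ`. -/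
theorem exponential_quadratic_ansatz_solves_pde
    (S γ lam σ thetaBar : ℝ) (hS : 0 < S) (hγ1 : γ < 1) (hγ0 : γ ≠ 0)
    (A₁ A₂ A₃ : ℝ → ℝ)
    (hA₁0 : A₁ 0 = 0) (hA₂0 : A₂ 0 = 0) (hA₃0 : A₃ 0 = 0)
    (hA₁ : ∀ s ∈ Set.Icc (0 : ℝ) S,
      HasDerivWithinAt A₁ (-2 * lam * A₁ s + σ ^ 2 * A₁ s ^ 2 + γ / (1 - γ) ^ 2)
        (Set.Icc (0 : ℝ) S) s)
    (hA₂ : ∀ s ∈ Set.Icc (0 : ℝ) S,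
      HasDerivWithinAt A₂ (lam * (thetaBar * A₁ s - A₂ s) + σ ^ 2 * A₁ s * A₂ s)
        (Set.Icc (0 : ℝ) S) s)
    (hA₃ : ∀ s ∈ Set.Icc (0 : ℝ) S,
      HasDerivWithinAt A₃ (lam * thetaBar * A₂ s + σ ^ 2 / 2 * (A₁ s + A₂ s ^ 2))
        (Set.Icc (0 : ℝ) S) s)
    (g : ℝ → ℝ → ℝ)
    (hg : ∀ s θ : ℝ, g s θ = Real.exp (A₁ s * θ ^ 2 / 2 + A₂ s * θ + A₃ s)) :
    (∀ θ : ℝ, g 0 θ = 1) ∧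
    ∀ s ∈ Set.Icc (0 : ℝ) S, ∀ θ : ℝ,
      derivWithin (fun s' => g s' θ) (Set.Icc (0 : ℝ) S) s
        + lam * (θ - thetaBar) * deriv (fun t => g s t) θ
        - σ ^ 2 / 2 * deriv (deriv (fun t => g s t)) θ
        - (γ / (2 * (1 - γ)) + γ ^ 2 / (2 * (1 - γ) ^ 2)) * θ ^ 2 * g s θ = 0 := by
  constructor
  · intro θ
    simp [hg, hA₁0, hA₂0, hA₃0]
  intro s hs θ
  have hne : (1 - γ) ≠ 0 := by linarith
  have hs1 := ((((hA₁ s hs).mul_const (θ ^ 2)).div_const 2).add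
    ((hA₂ s hs).mul_const θ)).add (hA₃ s hs)
  have d1 := hs1.exp.derivWithin (uniqueDiffOn_Icc hS s hs)
  have e1 : (fun s' => g s' θ) =
      fun s' => Real.exp (A₁ s' * θ ^ 2 / 2 + A₂ s' * θ + A₃ s') := by
    funext x
    exact hg x θ
  have hq : ∀ t : ℝ, HasDerivAt (fun t => g s t) (g s t * (A₁ s * t + A₂ s)) t := by
    intro t
    have h : HasDerivAt (fun t : ℝ => A₁ s * t ^ 2 / 2 + A₂ s * t + A₃ s)
        (A₁ s * t + A₂ s) t := by
      have h0 := (((((hasDerivAt_id t).pow 2).const_mul (A₁ s)).div_const 2).add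
        ((hasDerivAt_id t).const_mul (A₂ s))).add_const (A₃ s)
      refine h0.congr_deriv ?_
      simp
      ring
    have e : (fun t => g s t) =
        fun t => Real.exp (A₁ s * t ^ 2 / 2 + A₂ s * t + A₃ s) := by
      funext x
      exact hg s x
    rw [e, hg s t]
    exact h.exp
  have e2 : deriv (fun t => g s t) = fun t => g s t * (A₁ s * t + A₂ s) := by
    funext t
    exact (hq t).deriv
  have hl : HasDerivAt (fun t : ℝ => A₁ s * t + A₂ s) (A₁ s) θ := by
    simpa using ((hasDerivAt_id θ).const_mul (A₁ s)).add_const (A₂ s)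
  have e3 : deriv (fun t => g s t * (A₁ s * t + A₂ s)) θ =
      g s θ * (A₁ s * θ + A₂ s) * (A₁ s * θ + A₂ s) + g s θ * A₁ s :=
    ((hq θ).mul hl).deriv
  have e4 : derivWithin (fun s' => g s' θ) (Set.Icc (0 : ℝ) S) s = g s θ *
      ((-2 * lam * A₁ s + σ ^ 2 * A₁ s ^ 2 + γ / (1 - γ) ^ 2) * θ ^ 2 / 2
        + (lam * (thetaBar * A₁ s - A₂ s) + σ ^ 2 * A₁ s * A₂ s) * θ
        + (lam * thetaBar * A₂ s + σ ^ 2 / 2 * (A₁ s + A₂ s ^ 2))) := by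
    rw [e1, hg s θ]
    exact d1
  have hc : γ / (2 * (1 - γ)) + γ ^ 2 / (2 * (1 - γ) ^ 2) = γ / (1 - γ) ^ 2 / 2 := by
    field_simp
    ring
  rw [e4, e2, e3, hc]
  ring
end

section
/- Let (Ω, 𝒜, μ) be a measure space, ζ : Ω → (0,∞) measurable, y > 0, and c : Ω → [0,∞) measurable. Define c* : Ω → [0,∞) by c*(ω) = I(y·ζ(ω)). Assume that U∘c, U∘c*, ζ·c and ζ·c* are all μ-integrable and that ∫ ζ·c dμ ≤ ∫ ζ·c* dμ. Then ∫ U∘c dμ ≤ ∫ U∘c* dμ. -/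
open MeasureTheory

/-- Abstract verification lemma: the candidate `c*(ω) = I(y·ζ(ω))` maximizes expected
utility among all measurable nonnegative plans `c` satisfying the budget constraint
`∫ ζ·c dμ ≤ ∫ ζ·c* dμ`. -/
theorem candidate_maximizes_expected_utility
    {Ω : Type*} [MeasurableSpace Ω] (μ : Measure Ω)
    (U U' I : ℝ → ℝ)
    (hUcont : ContinuousOn U (Set.Ici 0))
    (hUmono : StrictMonoOn U (Set.Ici 0))
    (hUconc : StrictConcaveOn ℝ (Set.Ici 0) U)
    (hU' : ∀ c : ℝ, 0 < c → HasDerivAt U (U' c) c)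
    (hU'anti : StrictAntiOn U' (Set.Ioi 0))
    (hU'lim : Filter.Tendsto U' Filter.atTop (nhds 0))
    (hInonneg : ∀ y : ℝ, 0 < y → 0 ≤ I y)
    (hIinv : ∀ y : ℝ, 0 < y → 0 < I y → U' (I y) = y)
    (hIzero : ∀ y : ℝ, 0 < y → I y = 0 → ∀ c : ℝ, 0 < c → U' c ≤ y)
    (ζ : Ω → ℝ) (hζmeas : Measurable ζ) (hζpos : ∀ ω, 0 < ζ ω)
    (y : ℝ) (hy : 0 < y)
    (c : Ω → ℝ) (hcmeas : Measurable c) (hcnonneg : ∀ ω, 0 ≤ c ω)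
    (cstar : Ω → ℝ) (hcstar : ∀ ω, cstar ω = I (y * ζ ω))
    (hUc : Integrable (fun ω => U (c ω)) μ)
    (hUcstar : Integrable (fun ω => U (cstar ω)) μ)
    (hζc : Integrable (fun ω => ζ ω * c ω) μ)
    (hζcstar : Integrable (fun ω => ζ ω * cstar ω) μ)
    (hbudget : ∫ ω, ζ ω * c ω ∂μ ≤ ∫ ω, ζ ω * cstar ω ∂μ) :
    ∫ ω, U (c ω) ∂μ ≤ ∫ ω, U (cstar ω) ∂μ := by
  have key : ∀ q : ℝ, 0 < q → ∀ x : ℝ, 0 ≤ x → U x - q * x ≤ U (I q) - q * I q := by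
    intro q hq x hx
    have mvt : ∀ a b : ℝ, 0 ≤ a → a < b → ∃ d ∈ Set.Ioo a b, U' d * (b - a) = U b - U a := by
      intro a b ha hab
      obtain ⟨d, hd, h⟩ := exists_hasDerivAt_eq_slope U U' hab
        (hUcont.mono fun t ht => le_trans ha ht.1) (fun t ht => hU' t (lt_of_le_of_lt ha ht.1))
      refine ⟨d, hd, ?_⟩
      have : b - a ≠ 0 := by linarith
      rw [h]
      field_simp
    have h0 := hInonneg q hq
    rcases lt_trichotomy x (I q) with h | h | h
    · obtain ⟨d, hd, e⟩ := mvt x (I q) hx h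
      have hp : 0 < I q := lt_of_le_of_lt hx h
      have h1 := hU'anti (show d ∈ Set.Ioi 0 from lt_of_le_of_lt hx hd.1) hp hd.2
      rw [hIinv q hq hp] at h1
      nlinarith
    · rw [h]
    · obtain ⟨d, hd, e⟩ := mvt (I q) x h0 h
      have hd0 : 0 < d := lt_of_le_of_lt h0 hd.1
      have h1 : U' d ≤ q := by
        rcases h0.eq_or_lt with h0 | hp
        · exact hIzero q hq h0.symm d hd0
        · have h1 := hU'anti (show I q ∈ Set.Ioi 0 from hp) hd0 hd.1
          rw [hIinv q hq hp] at h1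
          exact h1.le
      nlinarith
  have hm : ∫ ω, (U (c ω) - y * (ζ ω * c ω)) ∂μ
      ≤ ∫ ω, (U (cstar ω) - y * (ζ ω * cstar ω)) ∂μ := by
    refine integral_mono (hUc.sub (hζc.const_mul y)) (hUcstar.sub (hζcstar.const_mul y)) ?_
    intro ω
    have := key (y * ζ ω) (mul_pos hy (hζpos ω)) (c ω) (hcnonneg ω)
    rw [← hcstar ω] at this
    simpa only [mul_assoc] using this
  rw [integral_sub hUc (hζc.const_mul y), integral_sub hUcstar (hζcstar.const_mul y),
    integral_const_mul, integral_const_mul] at hm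
  have := mul_le_mul_of_nonneg_left hbudget hy.le
  linarith
end

section
/- For i = 1, 2, 3, let 𝓗ᵢ : (0,∞) → (0,∞) be a continuous strictly decreasing bijection with inverse 𝓨ᵢ, and let Vᵢ : (0,∞) → ℝ be differentiable with Vᵢ′ = 𝓨ᵢ. Set 𝓗 := 𝓗₁ + 𝓗₂ + 𝓗₃, which is a continuous strictly decreasing bijection of (0,∞) onto (0,∞), with inverse 𝓨. Then for every x > 0, defining xᵢ := 𝓗ᵢ(𝓨(x)) for i = 1, 2, 3, one has x₁ + x₂ + x₃ = x, and for all a₁, a₂, a₃ > 0 with a₁ + a₂ + a₃ = x: V₁(a₁) + V₂(a₂) + V₃(a₃) ≤ V₁(x₁) + V₂(x₂) + V₃(x₃). -/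
theorem tangent_bound_aux (H Z V : ℝ → ℝ) (hanti : StrictAntiOn H (Set.Ioi 0))
    (hb : Set.BijOn H (Set.Ioi 0) (Set.Ioi 0))
    (hZ : ∀ x : ℝ, 0 < x → 0 < Z x ∧ H (Z x) = x)
    (hV : ∀ x : ℝ, 0 < x → HasDerivAt V (Z x) x)
    (y : ℝ) (hy : 0 < y) (a : ℝ) (ha : 0 < a) :
    V a ≤ V (H y) + y * (a - H y) := by
  have hbp : 0 < H y := hb.mapsTo hy
  rcases lt_trichotomy a (H y) with h | h | h
  · obtain ⟨c, hc, he⟩ := exists_hasDerivAt_eq_slope V Z h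
      (fun t ht => (hV t (lt_of_lt_of_le ha ht.1)).continuousAt.continuousWithinAt)
      (fun t ht => hV t (lt_trans ha ht.1))
    have hc0 : 0 < c := lt_trans ha hc.1
    obtain ⟨hz, hz'⟩ := hZ c hc0
    have hle : y ≤ Z c := by
      by_contra! hlt
      have := hanti (Set.mem_Ioi.2 hz) (Set.mem_Ioi.2 hy) hlt
      linarith [hc.2]
    rw [eq_div_iff (by linarith)] at he
    nlinarith
  · subst h; simp
  · obtain ⟨c, hc, he⟩ := exists_hasDerivAt_eq_slope V Z h
      (fun t ht => (hV t (lt_of_lt_of_le hbp ht.1)).continuousAt.continuousWithinAt)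
      (fun t ht => hV t (lt_trans hbp ht.1))
    have hc0 : 0 < c := lt_trans hbp hc.1
    obtain ⟨hz, hz'⟩ := hZ c hc0
    have hle : Z c ≤ y := by
      by_contra! hlt
      have := hanti (Set.mem_Ioi.2 hy) (Set.mem_Ioi.2 hz) hlt
      linarith [hc.1]
    rw [eq_div_iff (by linarith)] at he
    nlinarith

/-- Optimal splitting of initial wealth: if `𝓗ᵢ` are continuous strictly decreasing
bijections of `(0,∞)` onto itself with inverses `𝓨ᵢ`, and `Vᵢ` are differentiable with
`Vᵢ′ = 𝓨ᵢ`, then `𝓗 := 𝓗₁ + 𝓗₂ + 𝓗₃` is a continuous strictly decreasing bijection of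
`(0,∞)` onto itself, and for every `x > 0` the allocation `xᵢ := 𝓗ᵢ(𝓨(x))` sums to `x`
and maximizes `V₁(a₁) + V₂(a₂) + V₃(a₃)` over positive allocations summing to `x`. -/
theorem optimal_initial_allocation
    (H₁ H₂ H₃ Y₁ Y₂ Y₃ Y V₁ V₂ V₃ : ℝ → ℝ)
    (hH₁cont : ContinuousOn H₁ (Set.Ioi 0))
    (hH₂cont : ContinuousOn H₂ (Set.Ioi 0))
    (hH₃cont : ContinuousOn H₃ (Set.Ioi 0))
    (hH₁anti : StrictAntiOn H₁ (Set.Ioi 0))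
    (hH₂anti : StrictAntiOn H₂ (Set.Ioi 0))
    (hH₃anti : StrictAntiOn H₃ (Set.Ioi 0))
    (hH₁bij : Set.BijOn H₁ (Set.Ioi 0) (Set.Ioi 0))
    (hH₂bij : Set.BijOn H₂ (Set.Ioi 0) (Set.Ioi 0))
    (hH₃bij : Set.BijOn H₃ (Set.Ioi 0) (Set.Ioi 0))
    (hY₁ : ∀ x : ℝ, 0 < x → 0 < Y₁ x ∧ H₁ (Y₁ x) = x)
    (hY₂ : ∀ x : ℝ, 0 < x → 0 < Y₂ x ∧ H₂ (Y₂ x) = x)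
    (hY₃ : ∀ x : ℝ, 0 < x → 0 < Y₃ x ∧ H₃ (Y₃ x) = x)
    (hY₁H : ∀ y : ℝ, 0 < y → Y₁ (H₁ y) = y)
    (hY₂H : ∀ y : ℝ, 0 < y → Y₂ (H₂ y) = y)
    (hY₃H : ∀ y : ℝ, 0 < y → Y₃ (H₃ y) = y)
    (hV₁ : ∀ x : ℝ, 0 < x → HasDerivAt V₁ (Y₁ x) x)
    (hV₂ : ∀ x : ℝ, 0 < x → HasDerivAt V₂ (Y₂ x) x)
    (hV₃ : ∀ x : ℝ, 0 < x → HasDerivAt V₃ (Y₃ x) x)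
    (hY : ∀ x : ℝ, 0 < x → 0 < Y x ∧ H₁ (Y x) + H₂ (Y x) + H₃ (Y x) = x) :
    (ContinuousOn (fun y => H₁ y + H₂ y + H₃ y) (Set.Ioi 0) ∧
      StrictAntiOn (fun y => H₁ y + H₂ y + H₃ y) (Set.Ioi 0) ∧
      Set.BijOn (fun y => H₁ y + H₂ y + H₃ y) (Set.Ioi 0) (Set.Ioi 0)) ∧
    ∀ x : ℝ, 0 < x →
      H₁ (Y x) + H₂ (Y x) + H₃ (Y x) = x ∧
      ∀ a₁ a₂ a₃ : ℝ, 0 < a₁ → 0 < a₂ → 0 < a₃ → a₁ + a₂ + a₃ = x →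
        V₁ a₁ + V₂ a₂ + V₃ a₃ ≤ V₁ (H₁ (Y x)) + V₂ (H₂ (Y x)) + V₃ (H₃ (Y x)) := by
  have hA : StrictAntiOn (fun y => H₁ y + H₂ y + H₃ y) (Set.Ioi 0) := by
    intro a ha b hb hab
    have h1 := hH₁anti ha hb hab
    have h2 := hH₂anti ha hb hab
    have h3 := hH₃anti ha hb hab
    show H₁ b + H₂ b + H₃ b < H₁ a + H₂ a + H₃ a
    linarith
  refine ⟨⟨(hH₁cont.add hH₂cont).add hH₃cont, hA, ?_, hA.injOn, ?_⟩, ?_⟩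
  · intro a ha
    have h1 : 0 < H₁ a := hH₁bij.mapsTo ha
    have h2 : 0 < H₂ a := hH₂bij.mapsTo ha
    have h3 : 0 < H₃ a := hH₃bij.mapsTo ha
    show 0 < H₁ a + H₂ a + H₃ a
    linarith
  · intro x hx
    exact ⟨Y x, (hY x hx).1, (hY x hx).2⟩
  · intro x hx
    obtain ⟨hp, hs⟩ := hY x hx
    refine ⟨hs, fun a₁ a₂ a₃ h1 h2 h3 hsum => ?_⟩
    have b1 := tangent_bound_aux H₁ Y₁ V₁ hH₁anti hH₁bij hY₁ hV₁ (Y x) hp a₁ h1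
    have b2 := tangent_bound_aux H₂ Y₂ V₂ hH₂anti hH₂bij hY₂ hV₂ (Y x) hp a₂ h2
    have b3 := tangent_bound_aux H₃ Y₃ V₃ hH₃anti hH₃bij hY₃ hV₃ (Y x) hp a₃ h3
    have e : Y x * (a₁ - H₁ (Y x)) + Y x * (a₂ - H₂ (Y x)) + Y x * (a₃ - H₃ (Y x)) = 0 := by
      have : a₁ + a₂ + a₃ - (H₁ (Y x) + H₂ (Y x) + H₃ (Y x)) = 0 := by rw [hs, hsum, sub_self]
      linear_combination (Y x) * this
    linarith
end
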